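/- For any starting point s₀ ∈ H, the Douglas–Rachford sequences satisfy −(1/n) x_n → v_D, −(1/n) x̃_n → v_D, and −(1/n) ν_n → v_P as n → ∞. -/

import Mathlib

open scoped InnerProductSpace Pointwise Classical
open Filter Topology

noncomputable section

variable {H : Type*} [NormedAddCommGroup H] [InnerProductSpace ℝ H]

/-- The effective domain of an extended-real-valued function. -/
def fdom {α : Type*} (f : α → EReal) : Set α := {x | f x ≠ ⊤}

/-- The Fenchel conjugate `f*(u) = sup_x (⟪x, u⟫ - f x)`. -/
def fconj (f : H → EReal) : H → EReal :=
  fun u => ⨆ x : H, ((⟪x, u⟫_ℝ : ℝ) : EReal) - f x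

/-- The recession function `(rec f)(y) = sup_{x ∈ dom f} (f (x + y) - f x)`. -/
def recFn (f : H → EReal) : H → EReal :=
  fun y => ⨆ x ∈ fdom f, (f (x + y) - f x)

/-- A proper function: never `-∞` and not identically `+∞`. -/
def ProperFn {α : Type*} (f : α → EReal) : Prop := (∀ x, f x ≠ ⊥) ∧ ∃ x, f x ≠ ⊤

/-- Convexity of an extended-real-valued function, via convexity of its epigraph. -/
def ConvexFn (f : H → EReal) : Prop :=
  Convex ℝ {p : H × ℝ | f p.1 ≤ (p.2 : EReal)}

/-- `v` is the element of minimum norm of `S`, i.e. `v = P_S 0`, the metric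
projection of `0` onto `S`. -/
def IsMinNormPoint (S : Set H) (v : H) : Prop := v ∈ S ∧ ∀ w ∈ S, ‖v‖ ≤ ‖w‖

/-- `p` is the metric projection of `x` onto `S`, i.e. `p = P_S x`. -/
def IsProjOn (S : Set H) (x p : H) : Prop := p ∈ S ∧ ∀ w ∈ S, dist x p ≤ dist x w

/-- The polar cone `S° = {u | ∀ x ∈ S, ⟪x, u⟫ ≤ 0}`. -/
def polarCone (s : Set H) : Set H := {u | ∀ x ∈ s, ⟪x, u⟫_ℝ ≤ 0}

/-- The recession cone `rec S = {x | ∀ y ∈ S, x + y ∈ S}`. -/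
def recCone (s : Set H) : Set H := {x | ∀ y ∈ s, x + y ∈ s}

/-- `p = prox_f w`: `p` minimizes `y ↦ f y + ½‖y - w‖²`. -/
def IsProxOf (f : H → EReal) (w p : H) : Prop :=
  ∀ y : H, f p + ((1 / 2 * ‖p - w‖ ^ 2 : ℝ) : EReal) ≤ f y + ((1 / 2 * ‖y - w‖ ^ 2 : ℝ) : EReal)

/-! ### Real-valued descriptions of extended-real-valued convex functions -/

section ExtendedReal

lemma le_coe_iff_mem_fdom {α : Type*} {f : α → EReal} (hf : ∀ x, f x ≠ ⊥) {x : α} {r : ℝ} :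
    f x ≤ (r : EReal) ↔ x ∈ fdom f ∧ (f x).toReal ≤ r := by
  constructor
  · intro h
    have hx : f x ≠ ⊤ := fun h' => by simp [h'] at h
    refine ⟨hx, ?_⟩
    rwa [← EReal.coe_toReal hx (hf x), EReal.coe_le_coe_iff] at h
  · rintro ⟨hx, h⟩
    rwa [← EReal.coe_toReal hx (hf x), EReal.coe_le_coe_iff]

lemma ConvexFn.convexOn_toReal {f : H → EReal} (hf : ProperFn f) (hc : ConvexFn f) :
    ConvexOn ℝ (fdom f) (fun x => (f x).toReal) := by
  have key : ∀ ⦃x⦄, x ∈ fdom f → ∀ ⦃y⦄, y ∈ fdom f → ∀ ⦃a b : ℝ⦄, 0 ≤ a → 0 ≤ b → a + b = 1 →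
      a • x + b • y ∈ fdom f ∧
        (f (a • x + b • y)).toReal ≤ a • (f x).toReal + b • (f y).toReal := by
    intro x hx y hy a b ha hb hab
    have h := hc (x := (x, (f x).toReal)) ((le_coe_iff_mem_fdom hf.1).2 ⟨hx, le_rfl⟩)
      (y := (y, (f y).toReal)) ((le_coe_iff_mem_fdom hf.1).2 ⟨hy, le_rfl⟩) ha hb hab
    exact (le_coe_iff_mem_fdom hf.1).1 h
  exact ⟨fun x hx y hy a b ha hb hab => (key hx hy ha hb hab).1,
    fun x hx y hy a b ha hb hab => (key hx hy ha hb hab).2⟩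

lemma mem_fdom_fconj_iff {f : H → EReal} (hf : ProperFn f) {p : H} :
    p ∈ fdom (fconj f) ↔ ∃ M : ℝ, ∀ x ∈ fdom f, ⟪x, p⟫_ℝ - (f x).toReal ≤ M := by
  constructor
  · intro hp
    refine ⟨(fconj f p).toReal, fun x hx => ?_⟩
    have h : ((⟪x, p⟫_ℝ : ℝ) : EReal) - f x ≤ fconj f p :=
      le_iSup (fun x : H => ((⟪x, p⟫_ℝ : ℝ) : EReal) - f x) x
    have h' := h.trans (EReal.le_coe_toReal hp)
    rw [← EReal.coe_toReal hx (hf.1 x)] at h'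
    exact_mod_cast h'
  · rintro ⟨M, hM⟩
    have h : fconj f p ≤ (M : EReal) := by
      refine iSup_le fun x => ?_
      by_cases hx : x ∈ fdom f
      · rw [← EReal.coe_toReal hx (hf.1 x)]
        exact_mod_cast hM x hx
      · have : f x = ⊤ := not_not.1 hx
        simp [this]
    exact ne_top_of_le_ne_top (EReal.coe_ne_top M) h

lemma convex_fdom_fconj {f : H → EReal} (hf : ProperFn f) : Convex ℝ (fdom (fconj f)) := by
  intro p hp q hq a b ha hb hab
  rw [mem_fdom_fconj_iff hf] at *
  obtain ⟨M, hM⟩ := hp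
  obtain ⟨N, hN⟩ := hq
  refine ⟨a * M + b * N, fun x hx => ?_⟩
  have h1 := mul_le_mul_of_nonneg_left (hM x hx) ha
  have h2 := mul_le_mul_of_nonneg_left (hN x hx) hb
  rw [inner_add_right, inner_smul_right, inner_smul_right]
  have h3 : (f x).toReal = a * (f x).toReal + b * (f x).toReal := by rw [← add_mul, hab, one_mul]
  linarith

/-- The residual `w - p` of a proximal point `p` of `f` at `w` is a subgradient of `f` at `p`. -/
lemma IsProxOf.subgradient {f : H → EReal} (hf : ProperFn f) (hc : ConvexFn f) {w p : H}
    (hp : IsProxOf f w p) :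
    p ∈ fdom f ∧ ∀ y ∈ fdom f, (f p).toReal + ⟪w - p, y - p⟫_ℝ ≤ (f y).toReal := by
  have hp' : p ∈ fdom f := by
    obtain ⟨y, hy⟩ := hf.2
    intro htop
    have h := hp y
    rw [htop, EReal.top_add_coe, top_le_iff, ← EReal.coe_toReal hy (hf.1 y)] at h
    exact EReal.coe_ne_top _ (by exact_mod_cast h)
  refine ⟨hp', fun y hy => ?_⟩
  have hreal : ∀ z ∈ fdom f,
      (f p).toReal + 1 / 2 * ‖p - w‖ ^ 2 ≤ (f z).toReal + 1 / 2 * ‖z - w‖ ^ 2 := by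
    intro z hz
    have h := hp z
    rw [← EReal.coe_toReal hp' (hf.1 p), ← EReal.coe_toReal hz (hf.1 z)] at h
    exact_mod_cast h
  have hseg : ∀ t : ℝ, 0 < t → t ≤ 1 →
      (f p).toReal + ⟪w - p, y - p⟫_ℝ ≤ (f y).toReal + t * (1 / 2 * ‖y - p‖ ^ 2) := by
    intro t ht ht1
    have hcx := ConvexFn.convexOn_toReal hf hc
    have hmem := hcx.1 hp' hy (sub_nonneg.2 ht1) ht.le (by ring)
    have h1 := hcx.2 hp' hy (sub_nonneg.2 ht1) ht.le (by ring)
    have h2 := hreal _ hmem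
    have h3 : (1 - t) • p + t • y - w = (p - w) + t • (y - p) := by module
    rw [h3, norm_add_sq_real, inner_smul_right, norm_smul, Real.norm_of_nonneg ht.le] at h2
    have h4 : ⟪p - w, y - p⟫_ℝ = -⟪w - p, y - p⟫_ℝ := by rw [← inner_neg_left, neg_sub]
    simp only [smul_eq_mul] at h1
    rw [h4] at h2
    have h5 : t * ((f p).toReal + ⟪w - p, y - p⟫_ℝ) ≤
        t * ((f y).toReal + t * (1 / 2 * ‖y - p‖ ^ 2)) := by nlinarith
    exact le_of_mul_le_mul_left h5 ht
  have hlim : Tendsto (fun t : ℝ => (f y).toReal + t * (1 / 2 * ‖y - p‖ ^ 2)) (𝓝[>] 0)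
      (𝓝 ((f y).toReal + 0 * (1 / 2 * ‖y - p‖ ^ 2))) :=
    ((by fun_prop : Continuous fun t : ℝ => (f y).toReal + t * (1 / 2 * ‖y - p‖ ^ 2)).tendsto
      0).mono_left nhdsWithin_le_nhds
  rw [zero_mul, add_zero] at hlim
  refine ge_of_tendsto hlim ?_
  filter_upwards [Ioc_mem_nhdsGT zero_lt_one] with t ht using hseg t ht.1 ht.2

lemma subgradient_mem_fdom_fconj {f : H → EReal} (hf : ProperFn f) {x u : H}
    (h : ∀ y ∈ fdom f, (f x).toReal + ⟪u, y - x⟫_ℝ ≤ (f y).toReal) : u ∈ fdom (fconj f) := by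
  refine (mem_fdom_fconj_iff hf).2 ⟨⟪u, x⟫_ℝ - (f x).toReal, fun y hy => ?_⟩
  have h1 := h y hy
  rw [inner_sub_right] at h1
  rw [real_inner_comm u y]
  linarith

lemma inner_sub_sub_ge_of_subgradient {f : H → EReal} {x u a p : H} {M : ℝ} (hx : x ∈ fdom f)
    (ha : a ∈ fdom f) (h : ∀ y ∈ fdom f, (f x).toReal + ⟪u, y - x⟫_ℝ ≤ (f y).toReal)
    (hp : ∀ y ∈ fdom f, ⟪y, p⟫_ℝ - (f y).toReal ≤ M) :
    ⟪a, p⟫_ℝ - (f a).toReal - M ≤ ⟪x - a, u - p⟫_ℝ := by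
  have h1 := h a ha
  have h2 := hp x hx
  simp only [inner_sub_left, inner_sub_right] at *
  rw [real_inner_comm a u, real_inner_comm x u] at h1
  linarith

/-- A uniform bound on `⟪d, ·⟫` over `dom f*` controls the growth of `f` in the direction `d`. -/
lemma add_mem_fdom_of_inner_le [CompleteSpace H] {f : H → EReal} (hf : ProperFn f)
    (hl : LowerSemicontinuous f) (hc : ConvexFn f) (hne : (fdom (fconj f)).Nonempty) {d : H} {K : ℝ}
    (hd : ∀ u ∈ fdom (fconj f), ⟪d, u⟫_ℝ ≤ K) {a : H} (ha : a ∈ fdom f) :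
    a + d ∈ fdom f ∧ (f (a + d)).toReal ≤ (f a).toReal + K := by
  rw [← le_coe_iff_mem_fdom hf.1]
  by_contra hcon
  have hclosed : IsClosed {p : H × ℝ | f p.1 ≤ (p.2 : EReal)} :=
    hl.isClosed_epigraph.preimage
      (f := fun p : H × ℝ => (p.1, (p.2 : EReal)))
      (continuous_fst.prodMk (continuous_coe_real_ereal.comp continuous_snd))
  obtain ⟨L, β, hL, hβ⟩ := geometric_hahn_banach_closed_point hc hclosed
    (x := (a + d, (f a).toReal + K)) hcon
  obtain ⟨ℓ, hℓ⟩ : ∃ ℓ : H, ∀ y, L (y, 0) = ⟪y, ℓ⟫_ℝ := by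
    refine ⟨(InnerProductSpace.toDual ℝ H).symm (L.comp (ContinuousLinearMap.inl ℝ H ℝ)),
      fun y => ?_⟩
    rw [real_inner_comm, InnerProductSpace.toDual_symm_apply]
    simp
  obtain ⟨τ, hτ⟩ : ∃ τ : ℝ, ∀ y r, L (y, r) = ⟪y, ℓ⟫_ℝ + r * τ := by
    refine ⟨L (0, 1), fun y r => ?_⟩
    rw [← hℓ, ← smul_eq_mul, ← map_smul, ← map_add]
    simp
  have hsep : ∀ y ∈ fdom f, ∀ r : ℝ, (f y).toReal ≤ r → ⟪y, ℓ⟫_ℝ + r * τ < β := by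
    intro y hy r hr
    rw [← hτ]
    exact hL (y, r) ((le_coe_iff_mem_fdom hf.1).2 ⟨hy, hr⟩)
  rw [hτ, inner_add_left] at hβ
  have ha' := hsep a ha _ le_rfl
  have hτ0 : τ ≤ 0 := by
    by_contra! hpos
    have h := hsep a ha ((f a).toReal + max 0 ((β - ⟪a, ℓ⟫_ℝ - (f a).toReal * τ) / τ))
      (le_add_of_nonneg_right (le_max_left _ _))
    have h2 := mul_le_mul_of_nonneg_right
      (le_max_right 0 ((β - ⟪a, ℓ⟫_ℝ - (f a).toReal * τ) / τ)) hpos.le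
    rw [div_mul_cancel₀ _ hpos.ne'] at h2
    linarith
  rcases hτ0.lt_or_eq with hneg | rfl
  · have hmem : (-τ)⁻¹ • ℓ ∈ fdom (fconj f) := by
      refine (mem_fdom_fconj_iff hf).2 ⟨(-τ)⁻¹ * β, fun y hy => ?_⟩
      have h := mul_le_mul_of_nonneg_left (hsep y hy _ le_rfl).le (inv_pos.2 (neg_pos.2 hneg)).le
      have h2 : (-τ)⁻¹ * ((f y).toReal * τ) = -(f y).toReal := by
        have := hneg.ne
        field_simp
      rw [inner_smul_right]
      linarith
    have h := hd _ hmem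
    rw [inner_smul_right, inv_mul_le_iff₀ (neg_pos.2 hneg)] at h
    linarith
  · obtain ⟨u₀, hu₀⟩ := hne
    obtain ⟨M, hM⟩ := (mem_fdom_fconj_iff hf).1 hu₀
    have hmem : ∀ t : ℝ, 0 ≤ t → u₀ + t • ℓ ∈ fdom (fconj f) := by
      intro t ht
      refine (mem_fdom_fconj_iff hf).2 ⟨M + t * β, fun y hy => ?_⟩
      have h1 := hM y hy
      have h2 := mul_le_mul_of_nonneg_left (hsep y hy _ le_rfl).le ht
      rw [inner_add_right, inner_smul_right]
      linarith
    have hdl : 0 < ⟪d, ℓ⟫_ℝ := by linarith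
    have h := hd _ (hmem ((|K - ⟪d, u₀⟫_ℝ| + 1) / ⟪d, ℓ⟫_ℝ) (by positivity))
    rw [inner_add_right, inner_smul_right, div_mul_cancel₀ _ hdl.ne'] at h
    linarith [le_abs_self (K - ⟪d, u₀⟫_ℝ)]

lemma add_nat_smul_mem_fdom_of_inner_le [CompleteSpace H] {f : H → EReal} (hf : ProperFn f)
    (hl : LowerSemicontinuous f) (hc : ConvexFn f) (hne : (fdom (fconj f)).Nonempty) {d : H} {K : ℝ}
    (hd : ∀ u ∈ fdom (fconj f), ⟪d, u⟫_ℝ ≤ K) {a : H} (ha : a ∈ fdom f) (n : ℕ) :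
    a + (n : ℝ) • d ∈ fdom f ∧ (f (a + (n : ℝ) • d)).toReal ≤ (f a).toReal + n * K := by
  refine add_mem_fdom_of_inner_le hf hl hc hne (fun u hu => ?_) ha
  rw [real_inner_smul_left]
  exact mul_le_mul_of_nonneg_left (hd u hu) n.cast_nonneg

lemma fconj_bound_add_nat_smul {f : H → EReal} {d : H} {K : ℝ}
    (hd : ∀ x ∈ fdom f, ⟪x, d⟫_ℝ ≤ K) {p : H} {M : ℝ}
    (hp : ∀ x ∈ fdom f, ⟪x, p⟫_ℝ - (f x).toReal ≤ M) (n : ℕ) :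
    ∀ x ∈ fdom f, ⟪x, p + (n : ℝ) • d⟫_ℝ - (f x).toReal ≤ M + n * K := by
  intro x hx
  have h := mul_le_mul_of_nonneg_left (hd x hx) (Nat.cast_nonneg (α := ℝ) n)
  rw [inner_add_right, inner_smul_right]
  linarith [hp x hx]

end ExtendedReal

lemma IsMinNormPoint.norm_sq_le_inner {S : Set H} (hS : Convex ℝ S) {v : H}
    (hv : IsMinNormPoint (closure S) v) {w : H} (hw : w ∈ S) : ‖v‖ ^ 2 ≤ ⟪v, w⟫_ℝ := by
  have h := (norm_eq_iInf_iff_real_inner_le_zero hS.closure (u := 0) hv.1).1 ?_ w (subset_closure hw)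
  · rw [zero_sub, inner_neg_left, inner_sub_right, real_inner_self_eq_norm_sq] at h
    linarith
  · have : Nonempty (closure S) := ⟨⟨v, hv.1⟩⟩
    refine le_antisymm (le_ciInf fun w => ?_) ?_
    · simpa using hv.2 w w.2
    · exact ciInf_le (f := fun w : closure S => ‖(0 : H) - w‖)
        ⟨0, by rintro _ ⟨w, rfl⟩; exact norm_nonneg _⟩ ⟨v, hv.1⟩

/-! ### Asymptotic estimates in inner product spaces -/

section Asymptotics

open Asymptotics

omit [InnerProductSpace ℝ H] in
lemma isLittleO_natCast_of_norm_sq_le {y : ℕ → H}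
    (h : ∀ ε > 0, ∃ C : ℝ, ∀ n : ℕ, ‖y n‖ ^ 2 ≤ ε * (n : ℝ) ^ 2 + C * (n + 1)) :
    y =o[atTop] (fun n : ℕ => (n : ℝ)) := by
  refine isLittleO_iff.2 fun c hc => ?_
  obtain ⟨C, hC⟩ := h (c ^ 2 / 2) (by positivity)
  have hlarge : ∀ᶠ n : ℕ in atTop, |C| * 4 / c ^ 2 ≤ (n : ℝ) :=
    tendsto_natCast_atTop_atTop.eventually_ge_atTop _
  filter_upwards [hlarge, eventually_ge_atTop 1] with n hn hn1
  have hn1' : (1 : ℝ) ≤ n := by exact_mod_cast hn1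
  rw [Real.norm_of_nonneg n.cast_nonneg]
  refine le_of_sq_le_sq ?_ (by positivity)
  rw [div_le_iff₀ (by positivity)] at hn
  have h1 : C * (n + 1) ≤ |C| * (2 * n) :=
    mul_le_mul (le_abs_self C) (by linarith) (by positivity) (abs_nonneg C)
  have h2 := mul_le_mul_of_nonneg_right hn (Nat.cast_nonneg (α := ℝ) n)
  have h3 := hC n
  nlinarith

omit [InnerProductSpace ℝ H] in
lemma isLittleO_natCast_of_norm_sq_le_add {y t : ℕ → H}
    (ht : t =o[atTop] (fun n : ℕ => (n : ℝ))) {C : ℝ}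
    (h : ∀ n : ℕ, ‖y n‖ ^ 2 ≤ ‖t n‖ ^ 2 + C * (n + 1)) :
    y =o[atTop] (fun n : ℕ => (n : ℝ)) := by
  refine isLittleO_iff.2 fun c hc => ?_
  have hlarge : ∀ᶠ n : ℕ in atTop, |C| * 4 / c ^ 2 ≤ (n : ℝ) :=
    tendsto_natCast_atTop_atTop.eventually_ge_atTop _
  filter_upwards [hlarge, eventually_ge_atTop 1, isLittleO_iff.1 ht (half_pos hc)] with n hn hn1 htn
  have hn1' : (1 : ℝ) ≤ n := by exact_mod_cast hn1
  rw [Real.norm_of_nonneg n.cast_nonneg] at *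
  refine le_of_sq_le_sq ?_ (by positivity)
  rw [div_le_iff₀ (by positivity)] at hn
  have h1 : C * (n + 1) ≤ |C| * (2 * n) :=
    mul_le_mul (le_abs_self C) (by linarith) (by positivity) (abs_nonneg C)
  have h2 := mul_le_mul_of_nonneg_right hn (Nat.cast_nonneg (α := ℝ) n)
  have h3 := h n
  have h4 := pow_le_pow_left₀ (norm_nonneg _) htn 2
  nlinarith [mul_pos hc hc, sq_nonneg (c * n)]

lemma tendsto_neg_inv_smul_of_isLittleO {y : ℕ → H} {v : H}
    (h : (fun n : ℕ => y n + (n : ℝ) • v) =o[atTop] (fun n : ℕ => (n : ℝ))) :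
    Tendsto (fun n : ℕ => (-((n : ℝ)⁻¹)) • y n) atTop (𝓝 v) := by
  have h1 : Tendsto (fun n : ℕ => (n : ℝ)⁻¹ • (y n + (n : ℝ) • v)) atTop (𝓝 0) := by
    rw [tendsto_zero_iff_norm_tendsto_zero]
    refine h.norm_left.tendsto_div_nhds_zero.congr fun n => ?_
    rw [norm_smul, norm_inv, Real.norm_of_nonneg n.cast_nonneg, div_eq_inv_mul]
  have h2 := h1.const_sub v
  rw [sub_zero] at h2
  refine h2.congr' ?_
  filter_upwards [eventually_ne_atTop 0] with n hn
  have hn' : (n : ℝ) ≠ 0 := by exact_mod_cast hn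
  rw [smul_add, smul_smul, inv_mul_cancel₀ hn', one_smul, neg_smul]
  abel

lemma isLittleO_add_natCast_smul_of_norm_sq_succ_le {s : ℕ → H} {v : H}
    (h : ∀ ε > 0, ∃ C : ℝ, ∀ n : ℕ,
      ‖s (n + 1)‖ ^ 2 ≤ ‖s n‖ ^ 2 - 2 * ⟪s n, v⟫_ℝ + ε * ‖s n‖ + C)
    (hv : ∀ n : ℕ, ‖v‖ ^ 2 ≤ ⟪v, s n - s (n + 1)⟫_ℝ) :
    (fun n : ℕ => s n + (n : ℝ) • v) =o[atTop] (fun n : ℕ => (n : ℝ)) := by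
  obtain ⟨K, hK0, hK⟩ : ∃ K : ℝ, 0 ≤ K ∧ ∀ n : ℕ, ‖s n‖ ≤ ‖s 0‖ + n * K := by
    obtain ⟨C, hC⟩ := h 1 one_pos
    refine ⟨2 * ‖v‖ + 1 + |C|, by positivity, fun n => ?_⟩
    induction n with
    | zero => simp
    | succ n ih =>
      have hstep : ‖s (n + 1)‖ ≤ ‖s n‖ + (2 * ‖v‖ + 1 + |C|) := by
        refine le_of_sq_le_sq ?_ (by positivity)
        have h1 := hC n
        have h2 := neg_le_of_abs_le (abs_real_inner_le_norm (s n) v)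
        nlinarith [norm_nonneg (s n), norm_nonneg v, abs_nonneg C, le_abs_self C,
          mul_nonneg (norm_nonneg (s n)) (norm_nonneg v),
          mul_nonneg (norm_nonneg (s n)) (abs_nonneg C),
          mul_nonneg (norm_nonneg v) (abs_nonneg C)]
      push_cast
      linarith
  refine isLittleO_natCast_of_norm_sq_le fun ε hε => ?_
  obtain ⟨C, hC⟩ := h (ε / (K + 1)) (by positivity)
  have hδ : ε / (K + 1) * K ≤ ε := by
    rw [div_mul_eq_mul_div, div_le_iff₀ (by positivity)]
    nlinarith
  have hε' : 0 ≤ ε / (K + 1) := by positivity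
  set δ := ε / (K + 1)
  have hstep : ∀ n : ℕ, ‖s (n + 1) + ((n + 1 : ℕ) : ℝ) • v‖ ^ 2 ≤
      ‖s n + (n : ℝ) • v‖ ^ 2 + (δ * ‖s 0‖ + |C|) + ε * n := by
    intro n
    have hn : (0 : ℝ) ≤ n := n.cast_nonneg
    have h1 := hC n
    have h2 := mul_le_mul_of_nonneg_left (hv n) (by positivity : (0 : ℝ) ≤ n + 1)
    have h3 := mul_le_mul_of_nonneg_left (hK n) hε'
    have h4 := mul_le_mul_of_nonneg_right hδ hn
    rw [norm_add_sq_real, norm_add_sq_real, inner_smul_right, inner_smul_right, norm_smul,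
      norm_smul, Real.norm_of_nonneg hn, Real.norm_of_nonneg (by positivity)]
    rw [inner_sub_right, real_inner_comm (s n) v, real_inner_comm (s (n + 1)) v] at h2
    push_cast
    nlinarith [le_abs_self C, sq_nonneg ‖v‖]
  refine ⟨‖s 0‖ ^ 2 + (δ * ‖s 0‖ + |C|), fun n => ?_⟩
  have hsum : ‖s n + (n : ℝ) • v‖ ^ 2 ≤ ‖s 0‖ ^ 2 + n * (δ * ‖s 0‖ + |C|) + ε * (n : ℝ) ^ 2 := by
    induction n with
    | zero => simp
    | succ n ih =>
      have h1 := hstep n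
      have hn : (0 : ℝ) ≤ n := n.cast_nonneg
      push_cast at *
      nlinarith
  have hn : (0 : ℝ) ≤ n := n.cast_nonneg
  have h5 : 0 ≤ δ * ‖s 0‖ + |C| := by positivity
  nlinarith [mul_nonneg hn (sq_nonneg ‖s 0‖)]

lemma norm_le_add_of_le_inner {x s a p : H} {c : ℝ} (h : c ≤ ⟪x - a, s - x - p⟫_ℝ) :
    ‖x‖ ≤ ‖s‖ + (‖p + a‖ + ‖a‖ + |c| + 1) := by
  have h1 : ⟪x - a, s - x - p⟫_ℝ = ⟪x - a, s - (p + a)⟫_ℝ - ‖x - a‖ ^ 2 := by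
    rw [← real_inner_self_eq_norm_sq, ← inner_sub_right]
    congr 1
    abel
  have h2 := real_inner_le_norm (x - a) (s - (p + a))
  have h3 : ‖x - a‖ ≤ ‖s - (p + a)‖ + |c| + 1 := by
    by_contra! hlt
    nlinarith [neg_abs_le c, norm_nonneg (s - (p + a)), abs_nonneg c, norm_nonneg (x - a),
      mul_nonneg (norm_nonneg (x - a)) (abs_nonneg c)]
  have h4 := norm_sub_le s (p + a)
  have h5 := norm_sub_norm_le x a
  linarith

/-- The basic one-step estimate for the Douglas–Rachford operator, obtained by adding the
three-star monotonicity inequalities of the two subdifferentials. -/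
lemma norm_sub_sq_le_of_le_inner {x u w a b p q : H} {c c' : ℝ}
    (h : c ≤ ⟪x - a, u - p⟫_ℝ) (h' : c' ≤ ⟪x - w - b, w - u - q⟫_ℝ) :
    ‖x + u - w‖ ^ 2 ≤ ‖x + u‖ ^ 2 - 2 * ⟪x, p + q⟫_ℝ - 2 * ⟪u, a - b⟫_ℝ +
      (2 * (⟪a, p⟫_ℝ + ⟪b, q⟫_ℝ - c - c') + ‖q - b‖ ^ 2) := by
  have h1 := sq_nonneg ‖w - (q - b)‖
  rw [← real_inner_self_eq_norm_sq] at *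
  simp only [← real_inner_self_eq_norm_sq, inner_sub_left, inner_sub_right, inner_add_left,
    inner_add_right] at *
  rw [real_inner_comm u a, real_inner_comm w b, real_inner_comm u b, real_inner_comm w x,
    real_inner_comm w u] at *
  rw [real_inner_comm w q, real_inner_comm q b] at *
  linarith [real_inner_comm u x, real_inner_comm w u, real_inner_comm w x]

end Asymptotics

lemma nonpos_of_forall_nat_mul_le {r K : ℝ} (h : ∀ n : ℕ, n * r ≤ K) : r ≤ 0 := by
  by_contra! hr
  obtain ⟨n, hn⟩ := exists_nat_gt (K / r)
  rw [div_lt_iff₀ hr] at hn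
  linarith [h n]

omit [InnerProductSpace ℝ H] in
lemma exists_norm_sub_lt_of_mem_closure_add {S T : Set H} {v : H} (hv : v ∈ closure (S + T))
    {ε : ℝ} (hε : 0 < ε) : ∃ a ∈ S, ∃ b ∈ T, ‖a + b - v‖ < ε := by
  obtain ⟨_, ⟨a, ha, b, hb, rfl⟩, h⟩ := Metric.mem_closure_iff.1 hv ε hε
  exact ⟨a, ha, b, hb, by rwa [← dist_eq_norm, dist_comm]⟩

theorem douglasRachford_cesaro_tendsto {H : Type*} [NormedAddCommGroup H] [InnerProductSpace ℝ H]
    [FiniteDimensional ℝ H]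
    (f g : H → EReal)
    (hf_prop : ProperFn f) (hf_lsc : LowerSemicontinuous f) (hf_cvx : ConvexFn f)
    (hg_prop : ProperFn g) (hg_lsc : LowerSemicontinuous g) (hg_cvx : ConvexFn g)
    (vP : H) (hvP : IsMinNormPoint (closure (fdom f - fdom g)) vP)
    (vD : H) (hvD : IsMinNormPoint (closure (fdom (fconj f) + fdom (fconj g))) vD)
    (s₀ : H) (proxf proxg : H → H)
    (hproxf : ∀ w : H, IsProxOf f w (proxf w))
    (hproxg : ∀ w : H, IsProxOf g w (proxg w))
    (s x ν xt : ℕ → H)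
    (hs₀ : s 0 = s₀)
    (hx : ∀ n : ℕ, x n = proxf (s n))
    (hν : ∀ n : ℕ, ν n = s n - x n)
    (hxt : ∀ n : ℕ, xt n = proxg ((2 : ℝ) • x n - s n))
    (hs : ∀ n : ℕ, s (n + 1) = s n + xt n - x n)
    : Tendsto (fun n : ℕ => (-((n : ℝ)⁻¹)) • x n) atTop (𝓝 vD) ∧
      Tendsto (fun n : ℕ => (-((n : ℝ)⁻¹)) • xt n) atTop (𝓝 vD) ∧
      Tendsto (fun n : ℕ => (-((n : ℝ)⁻¹)) • ν n) atTop (𝓝 vP) := by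
  have hcF := ConvexFn.convexOn_toReal hf_prop hf_cvx
  have hcG := ConvexFn.convexOn_toReal hg_prop hg_cvx
  have hw : ∀ n, s (n + 1) = s n - (x n - xt n) := fun n => by rw [hs]; abel
  have hsx : ∀ n, s n = x n + ν n := fun n => by rw [hν]; abel
  have hF : ∀ n, x n ∈ fdom f ∧
      ∀ y ∈ fdom f, (f (x n)).toReal + ⟪ν n, y - x n⟫_ℝ ≤ (f y).toReal := fun n => by
    rw [hν, hx]
    exact (hproxf (s n)).subgradient hf_prop hf_cvx
  have hG : ∀ n, xt n ∈ fdom g ∧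
      ∀ y ∈ fdom g, (g (xt n)).toReal + ⟪x n - xt n - ν n, y - xt n⟫_ℝ ≤ (g y).toReal := by
    intro n
    have h := (hproxg ((2 : ℝ) • x n - s n)).subgradient hg_prop hg_cvx
    rw [← hxt, hsx n, show (2 : ℝ) • x n - (x n + ν n) - xt n = x n - xt n - ν n by module] at h
    exact h
  have hFs : ∀ n, ν n ∈ fdom (fconj f) := fun n => subgradient_mem_fdom_fconj hf_prop (hF n).2
  have hGs : ∀ n, x n - xt n - ν n ∈ fdom (fconj g) :=
    fun n => subgradient_mem_fdom_fconj hg_prop (hG n).2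
  -- the variational inequalities characterizing the two minimum norm points
  have hPin : ∀ a ∈ fdom f, ∀ b ∈ fdom g, ‖vP‖ ^ 2 ≤ ⟪vP, a - b⟫_ℝ := fun a ha b hb =>
    hvP.norm_sq_le_inner (hcF.1.sub hcG.1) (Set.sub_mem_sub ha hb)
  have hDin : ∀ p ∈ fdom (fconj f), ∀ q ∈ fdom (fconj g), ‖vD‖ ^ 2 ≤ ⟪vD, p + q⟫_ℝ :=
    fun p hp q hq => hvD.norm_sq_le_inner
      ((convex_fdom_fconj hf_prop).add (convex_fdom_fconj hg_prop)) (Set.add_mem_add hp hq)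
  -- `-vP` and `-vD` are recession directions
  obtain ⟨K₁, hK₁⟩ : ∃ K : ℝ, ∀ a ∈ fdom f, ⟪a, -vP⟫_ℝ ≤ K := by
    refine ⟨-⟪vP, xt 0⟫_ℝ, fun a ha => ?_⟩
    have h := hPin a ha _ (hG 0).1
    rw [inner_sub_right] at h
    rw [inner_neg_right, real_inner_comm]
    linarith [sq_nonneg ‖vP‖]
  obtain ⟨K₂, hK₂⟩ : ∃ K : ℝ, ∀ b ∈ fdom g, ⟪b, vP⟫_ℝ ≤ K := by
    refine ⟨⟪vP, x 0⟫_ℝ, fun b hb => ?_⟩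
    have h := hPin _ (hF 0).1 b hb
    rw [inner_sub_right] at h
    rw [real_inner_comm]
    linarith [sq_nonneg ‖vP‖]
  obtain ⟨K₃, hK₃⟩ : ∃ K : ℝ, ∀ p ∈ fdom (fconj f), ⟪-vD, p⟫_ℝ ≤ K := by
    refine ⟨⟪vD, x 0 - xt 0 - ν 0⟫_ℝ, fun p hp => ?_⟩
    have h := hDin p hp _ (hGs 0)
    rw [inner_add_right] at h
    rw [inner_neg_left]
    linarith [sq_nonneg ‖vD‖]
  obtain ⟨K₄, hK₄⟩ : ∃ K : ℝ, ∀ q ∈ fdom (fconj g), ⟪-vD, q⟫_ℝ ≤ K := by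
    refine ⟨⟪vD, ν 0⟫_ℝ, fun q hq => ?_⟩
    have h := hDin _ (hFs 0) q hq
    rw [inner_add_right] at h
    rw [inner_neg_left]
    linarith [sq_nonneg ‖vD‖]
  have hrecF : ∀ a ∈ fdom f, ∀ n : ℕ, a + (n : ℝ) • -vD ∈ fdom f ∧
      (f (a + (n : ℝ) • -vD)).toReal ≤ (f a).toReal + n * K₃ := fun a ha n =>
    add_nat_smul_mem_fdom_of_inner_le hf_prop hf_lsc hf_cvx ⟨_, hFs 0⟩ hK₃ ha n
  have hrecG : ∀ b ∈ fdom g, ∀ n : ℕ, b + (n : ℝ) • -vD ∈ fdom g ∧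
      (g (b + (n : ℝ) • -vD)).toReal ≤ (g b).toReal + n * K₄ := fun b hb n =>
    add_nat_smul_mem_fdom_of_inner_le hg_prop hg_lsc hg_cvx ⟨_, hGs 0⟩ hK₄ hb n
  have horth : ⟪vP, vD⟫_ℝ = 0 := by
    refine le_antisymm ?_ ?_
    · refine nonpos_of_forall_nat_mul_le (K := ⟪vP, x 0 - xt 0⟫_ℝ) fun n => ?_
      have h := hPin _ (hrecF _ (hF 0).1 n).1 _ (hG 0).1
      rw [add_sub_right_comm, inner_add_right, inner_smul_right, inner_neg_right] at h
      linarith [sq_nonneg ‖vP‖]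
    · refine neg_nonpos.1
        (nonpos_of_forall_nat_mul_le (K := ⟪vP, x 0 - xt 0⟫_ℝ) fun n => ?_)
      have h := hPin _ (hF 0).1 _ (hrecG _ (hG 0).1 n).1
      rw [← sub_sub, inner_sub_right, inner_smul_right, inner_neg_right] at h
      linarith [sq_nonneg ‖vP‖]
  obtain ⟨M₀, hM₀⟩ := (mem_fdom_fconj_iff hf_prop).1 (hFs 0)
  -- the governing sequence
  have hlo : (fun n : ℕ => s n + (n : ℝ) • (vP + vD)) =o[atTop] (fun n : ℕ => (n : ℝ)) := by
    refine isLittleO_add_natCast_smul_of_norm_sq_succ_le (fun ε hε => ?_) fun n => ?_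
    · obtain ⟨a, ha, b', hb', hab⟩ := exists_norm_sub_lt_of_mem_closure_add
        (sub_eq_add_neg (fdom f) (fdom g) ▸ hvP.1) (show 0 < ε / 6 by positivity)
      obtain ⟨p, hp, q, hq, hpq⟩ := exists_norm_sub_lt_of_mem_closure_add
        hvD.1 (show 0 < ε / 6 by positivity)
      obtain ⟨M, hM⟩ := (mem_fdom_fconj_iff hf_prop).1 hp
      obtain ⟨N, hN⟩ := (mem_fdom_fconj_iff hg_prop).1 hq
      have hb := hrecG (-b') hb' 1
      have hN' := fconj_bound_add_nat_smul hK₂ hN 1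
      rw [Nat.cast_one, one_smul] at hb hN'
      have hFn := fun n => inner_sub_sub_ge_of_subgradient (hF n).1 ha (hF n).2 hM
      have hGn := fun n => inner_sub_sub_ge_of_subgradient (hG n).1 hb.1 (hG n).2 hN'
      set c := ⟪a, p⟫_ℝ - (f a).toReal - M
      set c' := ⟪-b' + -vD, q + vP⟫_ℝ - (g (-b' + -vD)).toReal - (N + 1 * K₂)
      set C₁ := ‖p + a‖ + ‖a‖ + |c| + 1
      set C₂ := 2 * (⟪a, p⟫_ℝ + ⟪-b' + -vD, q + vP⟫_ℝ - c - c') +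
        ‖q + vP - (-b' + -vD)‖ ^ 2
      refine ⟨C₂ + ε * C₁, fun n => ?_⟩
      have h1 : ‖x n + ν n - (x n - xt n)‖ ^ 2 ≤ ‖x n + ν n‖ ^ 2 - 2 * ⟪x n, p + (q + vP)⟫_ℝ -
          2 * ⟪ν n, a - (-b' + -vD)⟫_ℝ + C₂ :=
        norm_sub_sq_le_of_le_inner (hFn n) (by rw [sub_sub_cancel]; exact hGn n)
      have h2 : ‖x n‖ ≤ ‖s n‖ + C₁ :=
        norm_le_add_of_le_inner (by rw [← hν]; exact hFn n)
      have h3 : ‖ν n‖ ≤ ‖s n‖ + ‖x n‖ := by rw [hν]; exact norm_sub_le _ _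
      have h4 : ⟪x n, p + (q + vP)⟫_ℝ = ⟪x n, vP + vD⟫_ℝ + ⟪x n, p + q - vD⟫_ℝ := by
        rw [← inner_add_right]; congr 1; abel
      have h5 : ⟪ν n, a - (-b' + -vD)⟫_ℝ = ⟪ν n, vP + vD⟫_ℝ + ⟪ν n, a + b' - vP⟫_ℝ := by
        rw [← inner_add_right]; congr 1; abel
      have h6 := neg_le_of_abs_le (abs_real_inner_le_norm (x n) (p + q - vD))
      have h7 := neg_le_of_abs_le (abs_real_inner_le_norm (ν n) (a + b' - vP))
      have h8 := mul_le_mul_of_nonneg_left hpq.le (norm_nonneg (x n))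
      have h9 := mul_le_mul_of_nonneg_left hab.le (norm_nonneg (ν n))
      have h10 : ε * ‖x n‖ ≤ ε * (‖s n‖ + C₁) := mul_le_mul_of_nonneg_left h2 hε.le
      have h11 : ε * ‖ν n‖ ≤ ε * (‖s n‖ + ‖x n‖) := mul_le_mul_of_nonneg_left h3 hε.le
      rw [← hsx, ← hw, h4, h5] at h1
      have h12 : ⟪s n, vP + vD⟫_ℝ = ⟪x n, vP + vD⟫_ℝ + ⟪ν n, vP + vD⟫_ℝ := by
        rw [hsx n, inner_add_left]
      have h13 : 0 ≤ ε * C₁ := by positivity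
      linarith
    · have h1 := hPin _ (hF n).1 _ (hG n).1
      have h2 := hDin _ (hFs n) _ (hGs n)
      rw [add_sub_cancel] at h2
      rw [hw, sub_sub_cancel, norm_add_sq_real, horth, inner_add_left]
      linarith
  -- splitting the governing sequence into the primal and dual parts
  have ha₀ := (hF 0).1
  have hkey : ∃ C : ℝ, ∀ n : ℕ, ‖x n + (n : ℝ) • vD - x 0‖ ^ 2 + ‖ν n + (n : ℝ) • vP - ν 0‖ ^ 2 ≤
      ‖s n + (n : ℝ) • (vP + vD) - s 0‖ ^ 2 + C * (n + 1) := by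
    refine ⟨2 * (|⟪x 0, ν 0⟫_ℝ| + |(f (x 0)).toReal| + |M₀| + |⟪x 0, vP⟫_ℝ| + |⟪vD, ν 0⟫_ℝ| +
      |K₃| + |K₁|), fun n => ?_⟩
    have hn : (0 : ℝ) ≤ n := n.cast_nonneg
    have hr := hrecF _ ha₀ n
    have h1 := inner_sub_sub_ge_of_subgradient (hF n).1 hr.1 (hF n).2
      (fconj_bound_add_nat_smul hK₁ hM₀ n)
    have h2 : s n + (n : ℝ) • (vP + vD) - s 0 =
        (x n + (n : ℝ) • vD - x 0) + (ν n + (n : ℝ) • vP - ν 0) := by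
      rw [hsx n, hsx 0]; module
    have h3 : x n - (x 0 + (n : ℝ) • -vD) = x n + (n : ℝ) • vD - x 0 := by module
    have h4 : ν n - (ν 0 + (n : ℝ) • -vP) = ν n + (n : ℝ) • vP - ν 0 := by module
    have h5 : ⟪x 0 + (n : ℝ) • -vD, ν 0 + (n : ℝ) • -vP⟫_ℝ =
        ⟪x 0, ν 0⟫_ℝ - n * ⟪x 0, vP⟫_ℝ - n * ⟪vD, ν 0⟫_ℝ := by
      simp only [inner_add_left, inner_add_right, inner_smul_right, real_inner_smul_left,
        inner_neg_left, inner_neg_right, real_inner_comm vP vD, horth]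
      ring
    rw [h3, h4, h5] at h1
    rw [h2, norm_add_sq_real]
    have hle : ∀ r : ℝ, r ≤ |r| * (n + 1) ∧ -r ≤ |r| * (n + 1) ∧ n * r ≤ |r| * (n + 1) := by
      intro r
      have e1 := mul_nonneg (abs_nonneg r) hn
      have e2 := mul_le_mul_of_nonneg_left (le_abs_self r) hn
      exact ⟨by linarith [le_abs_self r], by linarith [neg_le_abs r],
        by linarith [abs_nonneg r]⟩
    linarith [(hle ⟪x 0, ν 0⟫_ℝ).2.1, (hle (f (x 0)).toReal).1, (hle M₀).1,
      (hle ⟪x 0, vP⟫_ℝ).2.2, (hle ⟪vD, ν 0⟫_ℝ).2.2, (hle K₃).2.2, (hle K₁).2.2]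
  obtain ⟨C, hC⟩ := hkey
  have hconst : ∀ z : H, (fun _ : ℕ => z) =o[atTop] (fun n : ℕ => (n : ℝ)) := fun z =>
    (Asymptotics.isLittleO_const_left.2 (Or.inr
      (tendsto_norm_atTop_atTop.comp tendsto_natCast_atTop_atTop)))
  have hlo₀ := hlo.sub (hconst (s 0))
  have hX : (fun n : ℕ => x n + (n : ℝ) • vD) =o[atTop] (fun n : ℕ => (n : ℝ)) := by
    have h := isLittleO_natCast_of_norm_sq_le_add (y := fun n : ℕ => x n + (n : ℝ) • vD - x 0)
      hlo₀ (fun n => (le_add_of_nonneg_right (sq_nonneg _)).trans (hC n))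
    simpa using h.add (hconst (x 0))
  have hV : (fun n : ℕ => ν n + (n : ℝ) • vP) =o[atTop] (fun n : ℕ => (n : ℝ)) := by
    have h := isLittleO_natCast_of_norm_sq_le_add (y := fun n : ℕ => ν n + (n : ℝ) • vP - ν 0)
      hlo₀ (fun n => (le_add_of_nonneg_left (sq_nonneg _)).trans (hC n))
    simpa using h.add (hconst (ν 0))
  have hXt : (fun n : ℕ => xt n + (n : ℝ) • vD) =o[atTop] (fun n : ℕ => (n : ℝ)) := by
    have hshift : (fun n : ℕ => ((n + 1 : ℕ) : ℝ)) =O[atTop] (fun n : ℕ => (n : ℝ)) := by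
      refine Asymptotics.IsBigO.of_bound 2 ?_
      filter_upwards [eventually_ge_atTop 1] with n hn
      have hn' : (1 : ℝ) ≤ n := by exact_mod_cast hn
      rw [Real.norm_of_nonneg (by positivity), Real.norm_of_nonneg (by positivity)]
      push_cast
      linarith
    have hsucc := (hlo.comp_tendsto (tendsto_add_atTop_nat 1)).trans_isBigO hshift
    refine (((hX.add hsucc).sub hlo).sub (hconst (vP + vD))).congr_left fun n => ?_
    simp only [Function.comp_apply]
    rw [hs n]
    push_cast
    module
  exact ⟨tendsto_neg_inv_smul_of_isLittleO hX, tendsto_neg_inv_smul_of_isLittleO hXt,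
    tendsto_neg_inv_smul_of_isLittleO hV⟩

end
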